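/- Let n = 2 and suppose u ∈ H²(B₁(0)) satisfies, for some constants C, D ∈ ℝ and some ρ ∈ (0,1), Δu(x) = 0 for almost every x with |x| < ρ and Δu(x) = C·log|x| + D for almost every x with ρ < |x| < 1. Then u ∈ W^{3,1}_loc(B₁(0)) if and only if C·log ρ + D = 0. -/

import Mathlib

open MeasureTheory Metric Set Filter Topology
open scoped ENNReal

noncomputable section

/-- `n`-dimensional Euclidean space. -/
abbrev RH (n : ℕ) := EuclideanSpace ℝ (Fin n)

variable {n : ℕ}

/-- Smooth compactly supported test functions with support contained in `Ω`. -/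
def IsTestFun (Ω : Set (RH n)) (φ : RH n → ℝ) : Prop :=
  ContDiff ℝ (⊤ : ℕ∞) φ ∧ HasCompactSupport φ ∧ tsupport φ ⊆ Ω

/-- Classical partial derivative in the `i`-th coordinate direction. -/
def cpderiv (i : Fin n) (φ : RH n → ℝ) : RH n → ℝ :=
  fun x => fderiv ℝ φ x (EuclideanSpace.single i 1)

/-- Classical Laplacian of a (smooth) function. -/
def cLaplacian (φ : RH n → ℝ) : RH n → ℝ :=
  fun x => ∑ i, cpderiv i (cpderiv i φ) x

/-- `g` is the weak `i`-th partial derivative of `u` on `Ω`. -/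
def IsWeakPartial (Ω : Set (RH n)) (i : Fin n) (u g : RH n → ℝ) : Prop :=
  ∀ φ : RH n → ℝ, IsTestFun Ω φ →
    ∫ x in Ω, u x * cpderiv i φ x = - ∫ x in Ω, g x * φ x

/-- `g` is a weak Laplacian of `u` on `Ω`. -/
def IsWeakLaplacian (Ω : Set (RH n)) (u g : RH n → ℝ) : Prop :=
  ∀ φ : RH n → ℝ, IsTestFun Ω φ →
    ∫ x in Ω, u x * cLaplacian φ x = ∫ x in Ω, g x * φ x

/-- `u ∈ H²(Ω)` with weak gradient `g` and weak Hessian `h`. -/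
def IsH2With (Ω : Set (RH n)) (u : RH n → ℝ) (g : Fin n → RH n → ℝ)
    (h : Fin n → Fin n → RH n → ℝ) : Prop :=
  MemLp u 2 (volume.restrict Ω) ∧
  (∀ i, IsWeakPartial Ω i u (g i) ∧ MemLp (g i) 2 (volume.restrict Ω)) ∧
  (∀ i j, IsWeakPartial Ω j (g i) (h i j) ∧ MemLp (h i j) 2 (volume.restrict Ω))

/-- `u ∈ H²(Ω)`. -/
def MemH2 (Ω : Set (RH n)) (u : RH n → ℝ) : Prop :=
  ∃ g h, IsH2With Ω u g h

/-- `u ∈ H₀²(Ω)`: `u ∈ H²(Ω)` and `u` is approximable in the `H²`-norm by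
test functions supported in `Ω`. -/
def MemH20 (Ω : Set (RH n)) (u : RH n → ℝ) : Prop :=
  ∃ g h, IsH2With Ω u g h ∧
    ∃ φ : ℕ → RH n → ℝ, (∀ k, IsTestFun Ω (φ k)) ∧
      Tendsto (fun k => eLpNorm (fun x => u x - φ k x) 2 (volume.restrict Ω)) atTop (𝓝 0) ∧
      (∀ i, Tendsto (fun k => eLpNorm (fun x => g i x - cpderiv i (φ k) x) 2
        (volume.restrict Ω)) atTop (𝓝 0)) ∧
      (∀ i j, Tendsto (fun k => eLpNorm (fun x => h i j x - cpderiv j (cpderiv i (φ k)) x) 2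
        (volume.restrict Ω)) atTop (𝓝 0))

/-- `u ∈ H²_loc(ℝⁿ)`. -/
def MemH2loc (u : RH n → ℝ) : Prop :=
  ∀ Ω : Set (RH n), IsOpen Ω → Bornology.IsBounded Ω → MemH2 Ω u

/-- The two-sided biharmonic Alt–Caffarelli functional
`F(u,Ω) = ∫_Ω (Δu)² dx + |{x ∈ Ω : u x ≠ 0}|`, where the (weak) Laplacian
`Δu = lapu` is given explicitly. -/
def ACF (Ω : Set (RH n)) (lapu u : RH n → ℝ) : ℝ :=
  (∫ x in Ω, (lapu x) ^ 2) + (volume {x ∈ Ω | u x ≠ 0}).toReal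

/-- `u` is a global minimizer of the two-sided biharmonic Alt–Caffarelli functional. -/
def IsGlobalMinimizer (u : RH n → ℝ) : Prop :=
  MemH2loc u ∧
  ∀ Ω : Set (RH n), IsOpen Ω → Bornology.IsBounded Ω →
    ∀ v : RH n → ℝ, MemH2 Ω v → MemH20 Ω (fun x => v x - u x) →
      ∀ lapu lapv : RH n → ℝ, IsWeakLaplacian Ω u lapu → IsWeakLaplacian Ω v lapv →
        ACF Ω lapu u ≤ ACF Ω lapv v


/-- `u ∈ W^{3,q}(U)`: `u` and its weak derivatives up to order three lie in
`L^q(U)`. -/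
def MemW3q {n : ℕ} (U : Set (RH n)) (q : ℝ≥0∞) (u : RH n → ℝ) : Prop :=
  MemLp u q (volume.restrict U) ∧
  ∃ g : Fin n → RH n → ℝ,
    (∀ i, IsWeakPartial U i u (g i) ∧ MemLp (g i) q (volume.restrict U)) ∧
    ∃ h : Fin n → Fin n → RH n → ℝ,
      (∀ i j, IsWeakPartial U j (g i) (h i j) ∧ MemLp (h i j) q (volume.restrict U)) ∧
      ∃ k : Fin n → Fin n → Fin n → RH n → ℝ,
        ∀ i j l, IsWeakPartial U l (h i j) (k i j l) ∧ MemLp (k i j l) q (volume.restrict U)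

/-- `u ∈ W^{3,q}_loc(Ω)`. -/
def MemW3qLoc {n : ℕ} (Ω : Set (RH n)) (q : ℝ≥0∞) (u : RH n → ℝ) : Prop :=
  ∀ U : Set (RH n), IsOpen U → IsCompact (closure U) → closure U ⊆ Ω → MemW3q U q u


section Helpers

open scoped SchwartzMap LineDeriv Laplacian ContDiff
open TemperedDistribution

/-- A tempered distribution in `L²` whose distributional Laplacian is in `L²` belongs to `H²`. -/
theorem memSobolev_two_of_laplacian {f f' : Lp ℂ 2 (volume : Measure (RH n))}
    (h : Δ (f : 𝓢'(RH n, ℂ)) = (f' : 𝓢'(RH n, ℂ))) :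
    MemSobolev 2 2 (f : 𝓢'(RH n, ℂ)) := by
  set T : 𝓢'(RH n, ℂ) := (f : 𝓢'(RH n, ℂ)) with hT
  have h2 : T = besselPotential (RH n) ℂ 2 T -
      fourierMultiplierCLM ℂ (fun x ↦ Complex.ofReal (‖x‖ ^ 2)) T := by
    have h0 : fourierMultiplierCLM ℂ (fun _ : RH n ↦ (1 : ℂ)) T = T := by
      simp
    nth_rw 1 [← h0]
    rw [besselPotential, eq_sub_iff_add_eq]
    have hsum : (fun x : RH n ↦ (((1 + ‖x‖ ^ 2) ^ ((2 : ℝ) / 2) : ℝ) : ℂ)) =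
        (fun _ ↦ (1 : ℂ)) + fun x ↦ Complex.ofReal (‖x‖ ^ 2) := by
      ext x
      simp
    rw [hsum]
    simp only [fourierMultiplierCLM_apply]
    rw [smulLeftCLM_add (Function.HasTemperateGrowth.const 1) (by fun_prop)]
    simp [FourierTransform.fourierInv_add]
  have hc : ((-(2 * Real.pi) ^ 2 : ℝ) : ℂ) ≠ 0 := by
    simp [Real.pi_ne_zero]
  have h3 : fourierMultiplierCLM ℂ (fun x ↦ Complex.ofReal (‖x‖ ^ 2)) T
      = ((-(2 * Real.pi) ^ 2 : ℝ) : ℂ)⁻¹ • (f' : 𝓢'(RH n, ℂ)) := by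
    rw [← h, laplacian_eq_fourierMultiplierCLM, eq_inv_smul_iff₀ hc]
    rw [Complex.coe_smul]
  refine ⟨f + ((-(2 * Real.pi) ^ 2 : ℝ) : ℂ)⁻¹ • f', ?_⟩
  rw [← Lp.toTemperedDistributionCLM_apply]
  simp only [map_add, map_smul, Lp.toTemperedDistributionCLM_apply]
  rw [← h3]
  exact sub_eq_iff_eq_add.mp h2.symm

theorem exists_memLp_lineDerivOp_lineDerivOp {f F : RH n → ℂ} (hf : MemLp f 2 volume)
    (hF : MemLp F 2 volume)
    (h : ∀ ψ : 𝓢(RH n, ℂ), ∫ x, (Δ ψ : 𝓢(RH n, ℂ)) x * f x = ∫ x, ψ x * F x) (a b : RH n) :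
    ∃ k : RH n → ℂ, MemLp k 2 volume ∧
      ∀ ψ : 𝓢(RH n, ℂ), ∫ x, (∂_{a} (∂_{b} ψ) : 𝓢(RH n, ℂ)) x * f x = ∫ x, ψ x * k x := by
  have key := memSobolev_two_of_laplacian (f := hf.toLp f) (f' := hF.toLp F) (by
    ext ψ
    rw [laplacian_apply_apply, Lp.toTemperedDistribution_apply, Lp.toTemperedDistribution_apply]
    simp only [smul_eq_mul]
    refine Eq.trans (integral_congr_ae ?_) ((h ψ).trans (integral_congr_ae ?_))
    · filter_upwards [hf.coeFn_toLp] with x hx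
      rw [hx]
    · filter_upwards [hF.coeFn_toLp] with x hx
      rw [hx])
  have k2 := (key.lineDerivOp (m := a)).lineDerivOp (m := b)
  rw [show (2 - 1 - 1 : ℝ) = 0 by norm_num, memSobolev_zero_iff] at k2
  obtain ⟨k, hk⟩ := k2
  refine ⟨k, Lp.memLp k, fun ψ ↦ ?_⟩
  have := DFunLike.congr_fun hk ψ
  rw [lineDerivOp_apply_apply, map_neg, lineDerivOp_apply_apply, map_neg, neg_neg,
    Lp.toTemperedDistribution_apply, Lp.toTemperedDistribution_apply] at this
  simp only [smul_eq_mul] at this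
  rw [← this]
  refine integral_congr_ae ?_
  filter_upwards [hf.coeFn_toLp] with x hx
  rw [hx]

end Helpers

section TestFunctions

open scoped ContDiff

variable {Ω U : Set (RH n)} {φ χ p f : RH n → ℝ}

theorem ContDiff.cpderiv (hφ : ContDiff ℝ ∞ φ) (i : Fin n) : ContDiff ℝ ∞ (cpderiv i φ) := by
  have h : ContDiff ℝ ∞ (fderiv ℝ φ) := hφ.fderiv_right (m := ∞) (by simp)
  exact h.clm_apply contDiff_const

theorem ContDiff.cLaplacian (hφ : ContDiff ℝ ∞ φ) : ContDiff ℝ ∞ (cLaplacian φ) :=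
  ContDiff.sum fun i _ ↦ (hφ.cpderiv i).cpderiv i

theorem tsupport_cpderiv_subset (i : Fin n) : tsupport (cpderiv i φ) ⊆ tsupport φ :=
  tsupport_fderiv_apply_subset ℝ _

theorem IsTestFun.cpderiv (hφ : IsTestFun Ω φ) (i : Fin n) : IsTestFun Ω (cpderiv i φ) :=
  ⟨hφ.1.cpderiv i, hφ.2.1.mono' ((subset_tsupport _).trans (tsupport_cpderiv_subset i)),
    (tsupport_cpderiv_subset i).trans hφ.2.2⟩

theorem IsTestFun.mul_right (hφ : IsTestFun Ω φ) (hp : ContDiff ℝ ∞ p) :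
    IsTestFun Ω fun x ↦ φ x * p x :=
  ⟨hφ.1.mul hp, hφ.2.1.mul_right, tsupport_mul_subset_left.trans hφ.2.2⟩

theorem IsTestFun.add (hφ : IsTestFun Ω φ) (hχ : IsTestFun Ω χ) :
    IsTestFun Ω fun x ↦ φ x + χ x :=
  ⟨hφ.1.add hχ.1, hφ.2.1.add hχ.2.1,
    (tsupport_add φ χ).trans (union_subset hφ.2.2 hχ.2.2)⟩

theorem IsTestFun.zero : IsTestFun Ω fun _ ↦ 0 :=
  ⟨contDiff_const, .zero, by simp [tsupport]⟩

theorem IsTestFun.sum {ι : Type*} (s : Finset ι) {φ : ι → RH n → ℝ}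
    (hφ : ∀ i ∈ s, IsTestFun Ω (φ i)) : IsTestFun Ω fun x ↦ ∑ i ∈ s, φ i x := by
  classical
  induction s using Finset.induction_on with
  | empty => simpa using IsTestFun.zero
  | insert a s ha ih =>
    simp only [Finset.sum_insert ha]
    exact (hφ a (by simp)).add (ih fun i hi ↦ hφ i (by simp [hi]))

theorem IsTestFun.cLaplacian (hφ : IsTestFun Ω φ) : IsTestFun Ω (cLaplacian φ) :=
  IsTestFun.sum _ fun i _ ↦ (hφ.cpderiv i).cpderiv i

theorem IsTestFun.mono (hφ : IsTestFun U φ) (h : U ⊆ Ω) : IsTestFun Ω φ :=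
  ⟨hφ.1, hφ.2.1, hφ.2.2.trans h⟩

theorem IsTestFun.eq_zero (hφ : IsTestFun Ω φ) {x : RH n} (hx : x ∉ Ω) : φ x = 0 :=
  image_eq_zero_of_notMem_tsupport fun h ↦ hx (hφ.2.2 h)

theorem IsTestFun.setIntegral_mul (hφ : IsTestFun Ω φ) :
    ∫ x in Ω, f x * φ x = ∫ x, f x * φ x :=
  setIntegral_eq_integral_of_forall_compl_eq_zero fun x hx ↦ by simp [hφ.eq_zero hx]

theorem IsTestFun.setIntegral_mul_of_subset (hφ : IsTestFun U φ) (h : U ⊆ Ω) :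
    ∫ x in Ω, f x * φ x = ∫ x in U, f x * φ x := by
  rw [hφ.setIntegral_mul, (hφ.mono h).setIntegral_mul]

theorem IsTestFun.memLp_mul {μ : Measure (RH n)} {q : ℝ≥0∞} (hφ : IsTestFun Ω φ)
    (hf : MemLp f q μ) : MemLp (fun x ↦ f x * φ x) q μ :=
  (hφ.1.continuous.memLp_top_of_hasCompactSupport hφ.2.1 μ).mul hf

theorem IsTestFun.integrable_mul {μ : Measure (RH n)} (hφ : IsTestFun Ω φ)
    (hf : Integrable f μ) : Integrable (fun x ↦ f x * φ x) μ :=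
  memLp_one_iff_integrable.1 (hφ.memLp_mul (memLp_one_iff_integrable.2 hf))

theorem cpderiv_mul (hφ : ContDiff ℝ ∞ φ) (hp : ContDiff ℝ ∞ p) (i : Fin n) :
    cpderiv i (fun x ↦ φ x * p x) = fun x ↦ cpderiv i φ x * p x + φ x * cpderiv i p x := by
  ext x
  have h1 : DifferentiableAt ℝ φ x := hφ.differentiable (by simp) x
  have h2 : DifferentiableAt ℝ p x := hp.differentiable (by simp) x
  simp only [_root_.cpderiv]
  rw [fderiv_fun_mul h1 h2]
  simp
  ring

theorem cpderiv_add (hφ : ContDiff ℝ ∞ φ) (hp : ContDiff ℝ ∞ p) (i : Fin n) :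
    cpderiv i (fun x ↦ φ x + p x) = fun x ↦ cpderiv i φ x + cpderiv i p x := by
  ext x
  have h1 : DifferentiableAt ℝ φ x := hφ.differentiable (by simp) x
  have h2 : DifferentiableAt ℝ p x := hp.differentiable (by simp) x
  simp only [_root_.cpderiv]
  rw [fderiv_fun_add h1 h2]
  simp

theorem cpderiv_comm (hφ : ContDiff ℝ ∞ φ) (i j : Fin n) :
    cpderiv i (cpderiv j φ) = cpderiv j (cpderiv i φ) := by
  ext x
  have h : DifferentiableAt ℝ (fderiv ℝ φ) x :=
    (hφ.fderiv_right (m := ∞) (by simp)).differentiable (by simp) x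
  have hs : IsSymmSndFDerivAt ℝ φ x :=
    hφ.contDiffAt.isSymmSndFDerivAt (by
      simpa using (WithTop.coe_le_coe.2 le_top : ((2 : ℕ∞) : WithTop ℕ∞) ≤ ((⊤ : ℕ∞) : WithTop ℕ∞)))
  have key (a b : RH n) : fderiv ℝ (fun y ↦ fderiv ℝ φ y a) x b = fderiv ℝ (fderiv ℝ φ) x b a := by
    rw [fderiv_clm_apply h (by fun_prop)]
    simp
  change fderiv ℝ (fun y ↦ fderiv ℝ φ y _) x _ = fderiv ℝ (fun y ↦ fderiv ℝ φ y _) x _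
  rw [key, key, hs.eq]

/-- Leibniz rule for second derivatives, arranged so that `χ` is not differentiated against `p`. -/
theorem mul_cpderiv_cpderiv (hχ : ContDiff ℝ ∞ χ) (hp : ContDiff ℝ ∞ p) (j : Fin n) (x : RH n) :
    χ x * cpderiv j (cpderiv j p) x = cpderiv j (cpderiv j fun y ↦ χ y * p y) x
      - 2 * cpderiv j (fun y ↦ cpderiv j χ y * p y) x + cpderiv j (cpderiv j χ) x * p x := by
  rw [cpderiv_mul hχ hp, cpderiv_add ((hχ.cpderiv j).mul hp) (hχ.mul (hp.cpderiv j)),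
    cpderiv_mul hχ (hp.cpderiv j), cpderiv_mul (hχ.cpderiv j) hp]
  ring

end TestFunctions

section Regularity

open scoped ContDiff SchwartzMap LineDeriv Laplacian

variable {Ω U : Set (RH n)} {v F χ : RH n → ℝ} {w : Fin n → RH n → ℝ}

/-- The Laplacian of `χ v` when `v` has weak gradient `w` and weak Laplacian `F`. -/
def cutoffLaplacian (v F χ : RH n → ℝ) (w : Fin n → RH n → ℝ) : RH n → ℝ :=
  fun x ↦ F x * χ x + 2 * ∑ j, w j x * cpderiv j χ x + v x * cLaplacian χ x

theorem memLp_cutoffLaplacian {μ : Measure (RH n)} (hχ : IsTestFun Ω χ)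
    (hv : MemLp v 2 μ) (hF : MemLp F 2 μ) (hw : ∀ j, MemLp (w j) 2 μ) :
    MemLp (cutoffLaplacian v F χ w) 2 μ :=
  ((hχ.memLp_mul hF).add
    ((memLp_finsetSum _ fun j _ ↦ (hχ.cpderiv j).memLp_mul (hw j)).const_mul 2)).add
      (hχ.cLaplacian.memLp_mul hv)

theorem integral_mul_cutoffLaplacian (hχ : IsTestFun Ω χ)
    (hv : Integrable v (volume.restrict Ω)) (hF : Integrable F (volume.restrict Ω))
    (hw : ∀ j, Integrable (w j) (volume.restrict Ω))
    (hvw : ∀ j, IsWeakPartial Ω j v (w j)) (hvF : IsWeakLaplacian Ω v F)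
    {p : RH n → ℝ} (hp : ContDiff ℝ ∞ p) :
    ∫ x in Ω, v x * (χ x * cLaplacian p x) = ∫ x in Ω, cutoffLaplacian v F χ w x * p x := by
  have e1 : (fun x ↦ v x * (χ x * cLaplacian p x)) = fun x ↦
      (v x * cLaplacian (fun y ↦ χ y * p y) x
        - 2 * ∑ j, v x * cpderiv j (fun y ↦ cpderiv j χ y * p y) x)
        + v x * (cLaplacian χ x * p x) := by
    ext x
    simp only [cLaplacian, Finset.mul_sum, Finset.sum_mul, ← Finset.sum_sub_distrib,
      ← Finset.sum_add_distrib]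
    refine Finset.sum_congr rfl fun j _ ↦ ?_
    rw [mul_cpderiv_cpderiv hχ.1 hp]
    ring
  have e2 : (fun x ↦ cutoffLaplacian v F χ w x * p x) = fun x ↦
      (F x * (χ x * p x) + 2 * ∑ j, w j x * (cpderiv j χ x * p x))
        + v x * (cLaplacian χ x * p x) := by
    ext x
    simp only [cutoffLaplacian, add_mul, mul_assoc, Finset.sum_mul]
  have t1 := hχ.mul_right hp
  have t2 (j : Fin n) := (hχ.cpderiv j).mul_right hp
  have t3 := hχ.cLaplacian.mul_right hp
  have i2 (j : Fin n) := ((t2 j).cpderiv j).integrable_mul hv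
  have i2' (j : Fin n) := (t2 j).integrable_mul (hw j)
  rw [e1, e2, integral_add, integral_sub, integral_add, integral_add, integral_const_mul,
    integral_const_mul, integral_finsetSum _ fun j _ ↦ i2 j,
    integral_finsetSum _ fun j _ ↦ i2' j, hvF _ t1]
  · simp only [hvw _ _ (t2 _), Finset.sum_neg_distrib]
    ring
  · exact t1.integrable_mul hF
  · exact (integrable_finsetSum _ fun j _ ↦ i2' j).const_mul 2
  · exact (t1.integrable_mul hF).add ((integrable_finsetSum _ fun j _ ↦ i2' j).const_mul 2)
  · exact t3.integrable_mul hv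
  · exact t1.cLaplacian.integrable_mul hv
  · exact (integrable_finsetSum _ fun j _ ↦ i2 j).const_mul 2
  · exact (t1.cLaplacian.integrable_mul hv).sub
      ((integrable_finsetSum _ fun j _ ↦ i2 j).const_mul 2)
  · exact t3.integrable_mul hv

theorem cpderiv_re (ψ : 𝓢(RH n, ℂ)) (i : Fin n) :
    cpderiv i (fun x ↦ (ψ x).re) =
      fun x ↦ ((∂_{EuclideanSpace.single i (1 : ℝ)} ψ : 𝓢(RH n, ℂ)) x).re := by
  ext x
  have h := (Complex.reCLM.hasFDerivAt (x := ψ x)).comp x (ψ.hasFDerivAt x)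
  have h' : fderiv ℝ (fun x ↦ (ψ x).re) x = _ := h.fderiv
  rw [cpderiv, h', SchwartzMap.lineDerivOp_apply_eq_fderiv]
  rfl

theorem cpderiv_im (ψ : 𝓢(RH n, ℂ)) (i : Fin n) :
    cpderiv i (fun x ↦ (ψ x).im) =
      fun x ↦ ((∂_{EuclideanSpace.single i (1 : ℝ)} ψ : 𝓢(RH n, ℂ)) x).im := by
  ext x
  have h := (Complex.imCLM.hasFDerivAt (x := ψ x)).comp x (ψ.hasFDerivAt x)
  have h' : fderiv ℝ (fun x ↦ (ψ x).im) x = _ := h.fderiv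
  rw [cpderiv, h', SchwartzMap.lineDerivOp_apply_eq_fderiv]
  rfl

theorem laplacian_schwartz_eq (ψ : 𝓢(RH n, ℂ)) (x : RH n) :
    (Δ ψ : 𝓢(RH n, ℂ)) x = cLaplacian (fun x ↦ (ψ x).re) x
      + cLaplacian (fun x ↦ (ψ x).im) x * Complex.I := by
  rw [SchwartzMap.laplacian_eq_sum (EuclideanSpace.basisFun (Fin n) ℝ)]
  simp only [cLaplacian, cpderiv_re, cpderiv_im, sum_apply,
    EuclideanSpace.basisFun_apply]
  push_cast
  rw [Finset.sum_mul, ← Finset.sum_add_distrib]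
  exact Finset.sum_congr rfl fun i _ ↦ (Complex.re_add_im _).symm

theorem integral_laplacian_mul_cutoff (hΩ : MeasurableSet Ω) (hχ : IsTestFun Ω χ)
    (hv : Integrable v (volume.restrict Ω)) (hF : Integrable F (volume.restrict Ω))
    (hw : ∀ j, Integrable (w j) (volume.restrict Ω))
    (hvw : ∀ j, IsWeakPartial Ω j v (w j)) (hvF : IsWeakLaplacian Ω v F)
    (hF' : Integrable (cutoffLaplacian v F χ w) (volume.restrict Ω)) (ψ : 𝓢(RH n, ℂ)) :
    ∫ x, (Δ ψ : 𝓢(RH n, ℂ)) x * ((Ω.indicator (fun x ↦ v x * χ x) x : ℝ) : ℂ) =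
      ∫ x, ψ x * ((Ω.indicator (cutoffLaplacian v F χ w) x : ℝ) : ℂ) := by
  have hre : ContDiff ℝ ∞ fun x ↦ (ψ x).re := Complex.reCLM.contDiff.comp (ψ.smooth _)
  have him : ContDiff ℝ ∞ fun x ↦ (ψ x).im := Complex.imCLM.contDiff.comp (ψ.smooth _)
  have e1 : (fun x ↦ (Δ ψ : 𝓢(RH n, ℂ)) x * ((Ω.indicator (fun x ↦ v x * χ x) x : ℝ) : ℂ)) =
      Ω.indicator fun x ↦ ((v x * (χ x * cLaplacian (fun x ↦ (ψ x).re) x) : ℝ) : ℂ)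
        + ((v x * (χ x * cLaplacian (fun x ↦ (ψ x).im) x) : ℝ) : ℂ) * Complex.I := by
    ext x
    by_cases hx : x ∈ Ω
    · simp only [hx, indicator_of_mem, laplacian_schwartz_eq]
      push_cast
      ring
    · simp [hx]
  have e2 : (fun x ↦ ψ x * ((Ω.indicator (cutoffLaplacian v F χ w) x : ℝ) : ℂ)) =
      Ω.indicator fun x ↦ ((cutoffLaplacian v F χ w x * (ψ x).re : ℝ) : ℂ)
        + ((cutoffLaplacian v F χ w x * (ψ x).im : ℝ) : ℂ) * Complex.I := by
    ext x
    by_cases hx : x ∈ Ω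
    · simp only [hx, indicator_of_mem]
      nth_rw 1 [← Complex.re_add_im (ψ x)]
      push_cast
      ring
    · simp [hx]
  obtain ⟨C, hC⟩ := ψ.decay 0 0
  simp only [pow_zero, one_mul, norm_iteratedFDeriv_zero] at hC
  have b1 : Integrable (fun x ↦ cutoffLaplacian v F χ w x * (ψ x).re) (volume.restrict Ω) :=
    hF'.mul_bdd (c := C) hre.continuous.aestronglyMeasurable
      (.of_forall fun x ↦ (Complex.abs_re_le_norm _).trans (hC.2 x))
  have b2 : Integrable (fun x ↦ cutoffLaplacian v F χ w x * (ψ x).im) (volume.restrict Ω) :=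
    hF'.mul_bdd (c := C) him.continuous.aestronglyMeasurable
      (.of_forall fun x ↦ (Complex.abs_im_le_norm _).trans (hC.2 x))
  have a1 := (hχ.mul_right hre.cLaplacian).integrable_mul hv
  have a2 := (hχ.mul_right him.cLaplacian).integrable_mul hv
  rw [e1, e2, integral_indicator hΩ, integral_indicator hΩ,
    integral_add a1.ofReal (a2.ofReal.mul_const _), integral_add b1.ofReal (b2.ofReal.mul_const _),
    integral_mul_const, integral_mul_const, integral_complex_ofReal, integral_complex_ofReal,
    integral_complex_ofReal, integral_complex_ofReal,
    integral_mul_cutoffLaplacian hχ hv hF hw hvw hvF hre,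
    integral_mul_cutoffLaplacian hχ hv hF hw hvw hvF him]

/-- Interior `H²` regularity: a function in `H¹` whose weak Laplacian is in `L²` has second weak
derivatives in `L²` wherever the cutoff `χ` equals one. -/
theorem exists_memLp_cpderiv_cpderiv (hΩ : MeasurableSet Ω) [IsFiniteMeasure (volume.restrict Ω)]
    (hU : U ⊆ Ω) (hχ : IsTestFun Ω χ) (hχU : ∀ x ∈ U, χ x = 1)
    (hv : MemLp v 2 (volume.restrict Ω)) (hF : MemLp F 2 (volume.restrict Ω))
    (hw : ∀ j, MemLp (w j) 2 (volume.restrict Ω))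
    (hvw : ∀ j, IsWeakPartial Ω j v (w j)) (hvF : IsWeakLaplacian Ω v F) (j l : Fin n) :
    ∃ k : RH n → ℝ, MemLp k 2 volume ∧ ∀ φ, IsTestFun U φ →
      ∫ x in U, v x * cpderiv j (cpderiv l φ) x = ∫ x in U, k x * φ x := by
  have hF' := memLp_cutoffLaplacian hχ hv hF hw
  have m1 : MemLp (fun x ↦ ((Ω.indicator (fun x ↦ v x * χ x) x : ℝ) : ℂ)) 2 volume :=
    ((memLp_indicator_iff_restrict hΩ).2 (hχ.memLp_mul hv)).ofReal
  have m2 : MemLp (fun x ↦ ((Ω.indicator (cutoffLaplacian v F χ w) x : ℝ) : ℂ)) 2 volume :=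
    ((memLp_indicator_iff_restrict hΩ).2 hF').ofReal
  obtain ⟨k, hk, hkψ⟩ := exists_memLp_lineDerivOp_lineDerivOp m1 m2
    (integral_laplacian_mul_cutoff hΩ hχ (hv.integrable one_le_two) (hF.integrable one_le_two)
      (fun j ↦ (hw j).integrable one_le_two) hvw hvF (hF'.integrable one_le_two))
    (EuclideanSpace.single j (1 : ℝ)) (EuclideanSpace.single l (1 : ℝ))
  refine ⟨fun x ↦ (k x).re, hk.re, fun φ hφ ↦ ?_⟩
  have hs : HasCompactSupport fun x ↦ (φ x : ℂ) := hφ.2.1.comp_left (g := Complex.ofReal) rfl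
  have hc : ContDiff ℝ ∞ fun x ↦ (φ x : ℂ) := Complex.ofRealCLM.contDiff.comp hφ.1
  set ψ : 𝓢(RH n, ℂ) := hs.toSchwartzMap hc
  have hψx (x : RH n) : ψ x = φ x := rfl
  have hre : (fun x ↦ (ψ x).re) = φ := by
    ext x; simp [hψx]
  have h1 (x : RH n) : ((∂_{EuclideanSpace.single j (1 : ℝ)}
      (∂_{EuclideanSpace.single l (1 : ℝ)} ψ) : 𝓢(RH n, ℂ)) x).re
        = cpderiv j (cpderiv l φ) x := by
    rw [← hre, cpderiv_re, cpderiv_re]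
  have key := congrArg Complex.re (hkψ ψ)
  have int2 : Integrable (fun x ↦ ψ x * k x) volume := (ψ.memLp 2 volume).integrable_mul hk
  have int1 := ((∂_{EuclideanSpace.single j (1 : ℝ)}
      (∂_{EuclideanSpace.single l (1 : ℝ)} ψ) : 𝓢(RH n, ℂ)).memLp 2 volume).integrable_mul m1
  have r1 := integral_re int1
  have r2 := integral_re int2
  simp only [RCLike.re_to_complex] at r1 r2
  simp only [Pi.mul_apply] at r1
  rw [← r1, ← r2] at key
  rw [((hφ.cpderiv l).cpderiv j).setIntegral_mul, hφ.setIntegral_mul]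
  refine Eq.trans (integral_congr_ae (.of_forall fun x ↦ ?_))
    (key.trans (integral_congr_ae (.of_forall fun x ↦ ?_)))
  · simp only [Complex.re_mul_ofReal, h1]
    by_cases hx : x ∈ U
    · simp [hU hx, hχU x hx, mul_comm]
    · simp [((hφ.cpderiv l).cpderiv j).eq_zero hx]
  · simp [hψx, mul_comm]

end Regularity

section WeakDerivatives

open scoped ContDiff NNReal

variable {Ω U : Set (RH n)} {u f : RH n → ℝ}

theorem IsWeakPartial.mono {i : Fin n} {g : RH n → ℝ} (h : IsWeakPartial Ω i u g) (hU : U ⊆ Ω) :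
    IsWeakPartial U i u g := fun φ hφ ↦ by
  rw [← (hφ.cpderiv i).setIntegral_mul_of_subset hU, ← hφ.setIntegral_mul_of_subset hU,
    h φ (hφ.mono hU)]

theorem IsWeakPartial.sub {i : Fin n} {g f' : RH n → ℝ} (hu : Integrable u (volume.restrict Ω))
    (hf : Integrable f (volume.restrict Ω)) (hg : Integrable g (volume.restrict Ω))
    (hf' : Integrable f' (volume.restrict Ω)) (h : IsWeakPartial Ω i u g)
    (h' : IsWeakPartial Ω i f f') :
    IsWeakPartial Ω i (fun x ↦ u x - f x) fun x ↦ g x - f' x := fun φ hφ ↦ by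
  simp only [sub_mul]
  rw [integral_sub ((hφ.cpderiv i).integrable_mul hu) ((hφ.cpderiv i).integrable_mul hf),
    integral_sub (hφ.integrable_mul hg) (hφ.integrable_mul hf'), h φ hφ, h' φ hφ]
  ring

theorem IsWeakPartial.sum {ι : Type*} (s : Finset ι) {i : Fin n} {v w : ι → RH n → ℝ}
    (hv : ∀ j ∈ s, Integrable (v j) (volume.restrict Ω))
    (hw : ∀ j ∈ s, Integrable (w j) (volume.restrict Ω))
    (h : ∀ j ∈ s, IsWeakPartial Ω i (v j) (w j)) :
    IsWeakPartial Ω i (fun x ↦ ∑ j ∈ s, v j x) fun x ↦ ∑ j ∈ s, w j x := fun φ hφ ↦ by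
  simp only [Finset.sum_mul]
  rw [integral_finsetSum _ fun j hj ↦ (hφ.cpderiv i).integrable_mul (hv j hj),
    integral_finsetSum _ fun j hj ↦ hφ.integrable_mul (hw j hj), ← Finset.sum_neg_distrib]
  exact Finset.sum_congr rfl fun j hj ↦ h j hj φ hφ

theorem cpderiv_sum {ι : Type*} (s : Finset ι) {φ : ι → RH n → ℝ}
    (hφ : ∀ j ∈ s, ContDiff ℝ ∞ (φ j)) (i : Fin n) :
    cpderiv i (fun x ↦ ∑ j ∈ s, φ j x) = fun x ↦ ∑ j ∈ s, cpderiv i (φ j) x := by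
  ext x
  simp only [cpderiv]
  rw [fderiv_fun_sum fun j hj ↦ (hφ j hj).differentiable (by simp) x]
  simp

theorem cpderiv_cLaplacian {φ : RH n → ℝ} (hφ : ContDiff ℝ ∞ φ) (i : Fin n) :
    cpderiv i (cLaplacian φ) = cLaplacian (cpderiv i φ) := by
  have h : cpderiv i (cLaplacian φ) = _ :=
    cpderiv_sum Finset.univ (fun j _ ↦ (hφ.cpderiv j).cpderiv j) i
  rw [h]
  ext x
  refine Finset.sum_congr rfl fun j _ ↦ ?_
  rw [cpderiv_comm (hφ.cpderiv j), cpderiv_comm hφ]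

theorem LipschitzWith.isWeakPartial {K : ℝ≥0} (hf : LipschitzWith K f) (i : Fin n) :
    IsWeakPartial Ω i f fun x ↦ lineDeriv ℝ f x (EuclideanSpace.single i 1) := fun φ hφ ↦ by
  obtain ⟨M, hM⟩ := ContDiff.lipschitzWith_of_hasCompactSupport hφ.2.1 hφ.1 (by simp)
  rw [(hφ.cpderiv i).setIntegral_mul, hφ.setIntegral_mul,
    hf.integral_lineDeriv_mul_eq hM hφ.2.1, ← integral_neg]
  refine integral_congr_ae (.of_forall fun x ↦ ?_)
  simp only [map_neg, (hφ.1.differentiable (by simp) x).lineDeriv_eq_fderiv, cpderiv]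
  ring

theorem integral_mul_cLaplacian_cpderiv {g : Fin n → RH n → ℝ} {h : Fin n → Fin n → RH n → ℝ}
    (hu : Integrable u (volume.restrict Ω)) (hh : ∀ i, Integrable (h i i) (volume.restrict Ω))
    (hg : ∀ i, IsWeakPartial Ω i u (g i)) (hgh : ∀ i, IsWeakPartial Ω i (g i) (h i i))
    {φ : RH n → ℝ} (hφ : IsTestFun Ω φ) :
    ∫ x in Ω, u x * cLaplacian φ x = ∫ x in Ω, (∑ i, h i i x) * φ x := by
  simp only [cLaplacian, Finset.mul_sum, Finset.sum_mul]
  rw [integral_finsetSum _ fun i _ ↦ ((hφ.cpderiv i).cpderiv i).integrable_mul hu,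
    integral_finsetSum _ fun i _ ↦ hφ.integrable_mul (hh i)]
  refine Finset.sum_congr rfl fun i _ ↦ ?_
  rw [hg i _ (hφ.cpderiv i), hgh i _ hφ, neg_neg]

theorem lipschitzWith_log_max {ρ : ℝ} (hρ : 0 < ρ) (C D : ℝ) :
    ∃ K, LipschitzWith K fun x : RH n ↦ C * Real.log (max ‖x‖ ρ) + D := by
  have key (a b : ℝ) (ha : ρ ≤ a) (hb : ρ ≤ b) : Real.log a - Real.log b ≤ |a - b| / ρ := by
    have ha' := hρ.trans_le ha
    have hb' := hρ.trans_le hb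
    calc Real.log a - Real.log b = Real.log (a / b) := (Real.log_div ha'.ne' hb'.ne').symm
      _ ≤ a / b - 1 := Real.log_le_sub_one_of_pos (by positivity)
      _ = (a - b) / b := by field_simp
      _ ≤ |a - b| / b := by gcongr; exact le_abs_self _
      _ ≤ |a - b| / ρ := by gcongr
  refine ⟨(|C| / ρ).toNNReal, LipschitzWith.of_dist_le_mul fun x y ↦ ?_⟩
  rw [Real.coe_toNNReal _ (by positivity), Real.dist_eq, add_sub_add_right_eq_sub, ← mul_sub,
    abs_mul]
  have h1 : |Real.log (max ‖x‖ ρ) - Real.log (max ‖y‖ ρ)| ≤ |max ‖x‖ ρ - max ‖y‖ ρ| / ρ := by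
    refine abs_sub_le_iff.2 ⟨key _ _ (le_max_right _ _) (le_max_right _ _), ?_⟩
    rw [abs_sub_comm]
    exact key _ _ (le_max_right _ _) (le_max_right _ _)
  have h2 : |max ‖x‖ ρ - max ‖y‖ ρ| ≤ dist x y :=
    (abs_max_sub_max_le_abs _ _ _).trans ((abs_norm_sub_norm_le x y).trans (dist_eq_norm x y).ge)
  calc |C| * |Real.log (max ‖x‖ ρ) - Real.log (max ‖y‖ ρ)| ≤ |C| * (dist x y / ρ) := by
        gcongr
        exact h1.trans (by gcongr)
    _ = |C| / ρ * dist x y := by ring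

end WeakDerivatives

section Jump

open scoped ContDiff

/-- A nonzero multiple of the indicator function of a ball has no integrable weak gradient. -/
theorem eq_zero_of_isWeakPartial_indicator_ball {ρ r A : ℝ} (hρ : 0 < ρ) (hr : ρ < r)
    {i : Fin n} {m : RH n → ℝ} (hm : Integrable m (volume.restrict (ball 0 r)))
    (h : IsWeakPartial (ball 0 r) i ((ball (0 : RH n) ρ).indicator fun _ ↦ A) m) : A = 0 := by
  have hsub : ball (0 : RH n) ρ ⊆ ball 0 r := ball_subset_ball hr.le
  have hind {φ : RH n → ℝ} : ∫ x in ball 0 r, (ball (0 : RH n) ρ).indicator (fun _ ↦ A) x * φ x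
      = A * ∫ x in ball 0 ρ, φ x := by
    have : (fun x ↦ (ball (0 : RH n) ρ).indicator (fun _ ↦ A) x * φ x) =
        (ball (0 : RH n) ρ).indicator fun x ↦ A * φ x := by
      ext x
      by_cases hx : x ∈ ball (0 : RH n) ρ <;> simp [hx]
    rw [this, setIntegral_indicator measurableSet_ball, inter_eq_self_of_subset_right hsub,
      integral_const_mul]
  have hint0 {φ : RH n → ℝ} {V : Set (RH n)} (hφ : IsTestFun V φ) :
      ∫ x in V, cpderiv i φ x = 0 := by
    have := (LipschitzWith.const (1 : ℝ) : LipschitzWith 0 fun _ : RH n ↦ (1 : ℝ)).isWeakPartial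
      (Ω := V) i φ hφ
    simpa [lineDeriv] using this
  have h0 {V : Set (RH n)} (hVo : IsOpen V) (hV : V ⊆ ball 0 r)
      (hVφ : ∀ φ, IsTestFun V φ → ∫ x in ball 0 ρ, cpderiv i φ x = 0) :
      ∀ᵐ x, x ∈ V → m x = 0 := by
    refine hVo.ae_eq_zero_of_integral_contDiff_smul_eq_zero
      (IntegrableOn.locallyIntegrableOn (hm.mono_measure (Measure.restrict_mono hV le_rfl)))
      fun φ h1 h2 h3 ↦ ?_
    have hφ : IsTestFun V φ := ⟨h1, h2, h3⟩
    have := h φ (hφ.mono hV)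
    rw [hind, hVφ φ hφ, mul_zero, zero_eq_neg, (hφ.mono hV).setIntegral_mul] at this
    simpa [mul_comm] using this
  have hin := h0 isOpen_ball hsub fun φ hφ ↦ hint0 hφ
  have hout := h0 (V := ball 0 r \ closedBall 0 ρ) (isOpen_ball.sdiff isClosed_closedBall)
    sdiff_subset fun φ hφ ↦ by
      refine setIntegral_eq_zero_of_forall_eq_zero fun x hx ↦ (hφ.cpderiv i).eq_zero fun hx' ↦ ?_
      exact hx'.2 (ball_subset_closedBall hx)
  have hsph : ∀ᵐ x : RH n, x ∉ sphere (0 : RH n) ρ :=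
    measure_eq_zero_iff_ae_notMem.1 (Measure.addHaar_sphere_of_ne_zero _ _ hρ.ne')
  have hm0 : ∀ᵐ x, x ∈ ball (0 : RH n) r → m x = 0 := by
    filter_upwards [hin, hout, hsph] with x h1 h2 h3 hx
    by_cases h4 : x ∈ ball (0 : RH n) ρ
    · exact h1 h4
    · refine h2 ⟨hx, fun h5 ↦ ?_⟩
      rw [← ball_union_sphere] at h5
      exact h5.elim h4 h3
  let χ : ContDiffBump (0 : RH n) := ⟨ρ, (ρ + r) / 2, hρ, by linarith⟩
  have hlin : ContDiff ℝ ∞ fun x : RH n ↦ x i := by fun_prop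
  have hχ : IsTestFun (ball 0 r) fun x ↦ χ x * x i :=
    IsTestFun.mul_right ⟨χ.contDiff, χ.hasCompactSupport, by
      rw [χ.tsupport_eq]
      exact closedBall_subset_ball (by simp only [χ]; linarith)⟩ hlin
  have hd (x : RH n) (hx : x ∈ ball (0 : RH n) ρ) : cpderiv i (fun x ↦ χ x * x i) x = 1 := by
    have he : (fun x ↦ χ x * x i) =ᶠ[𝓝 x] EuclideanSpace.proj (𝕜 := ℝ) i := by
      filter_upwards [isOpen_ball.mem_nhds hx] with y hy
      simp [χ.one_of_mem_closedBall (ball_subset_closedBall hy)]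
    rw [cpderiv, he.fderiv_eq, ContinuousLinearMap.fderiv]
    simp
  have := h _ hχ
  rw [hind, setIntegral_congr_fun measurableSet_ball hd,
    setIntegral_eq_zero_of_ae_eq_zero (t := ball 0 r) (by
      filter_upwards [hm0] with x hx hx'
      rw [hx hx', zero_mul]), neg_zero, setIntegral_const, smul_eq_mul, mul_one] at this
  refine (mul_eq_zero.1 this).resolve_right ?_
  exact (ENNReal.toReal_pos (measure_ball_pos volume 0 hρ).ne' measure_ball_lt_top.ne).ne'

end Jump

/-- for `n = 2`, if `u ∈ H²(B₁(0))` has weak Laplacian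
`Δu = 0` on `{|x| < ρ}` and `Δu = C log|x| + D` on `{ρ < |x| < 1}`, then
`u ∈ W^{3,1}_loc(B₁(0))` iff `C log ρ + D = 0`. -/
theorem statement18 (u lapu : RH 2 → ℝ) (C D ρ : ℝ) (hρ : ρ ∈ Set.Ioo (0 : ℝ) 1)
    (hu : MemH2 (ball (0 : RH 2) 1) u)
    (hlapu : IsWeakLaplacian (ball (0 : RH 2) 1) u lapu)
    (hform : ∀ᵐ (x : RH 2) ∂volume.restrict (ball (0 : RH 2) 1),
      (‖x‖ < ρ → lapu x = 0) ∧ (ρ < ‖x‖ → lapu x = C * Real.log ‖x‖ + D)) :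
    MemW3qLoc (ball (0 : RH 2) 1) 1 u ↔ C * Real.log ρ + D = 0 := by
  obtain ⟨hρ0, hρ1⟩ := hρ
  set A : ℝ := C * Real.log ρ + D
  set Ω : Set (RH 2) := ball 0 1
  obtain ⟨g, h, hu2, hg, hh⟩ := hu
  have hfin : IsFiniteMeasure (volume.restrict Ω) := ⟨by simpa using measure_ball_lt_top⟩
  obtain ⟨K, hK⟩ := lipschitzWith_log_max (n := 2) hρ0 C D
  set w : RH 2 → ℝ := fun x ↦ C * Real.log (max ‖x‖ ρ) + D
  have hae : ∀ᵐ x ∂volume.restrict Ω,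
      lapu x = w x - (ball (0 : RH 2) ρ).indicator (fun _ ↦ A) x := by
    have hsph : ∀ᵐ x ∂volume.restrict Ω, x ∉ sphere (0 : RH 2) ρ :=
      ae_restrict_of_ae (measure_eq_zero_iff_ae_notMem.1
        (Measure.addHaar_sphere_of_ne_zero _ _ hρ0.ne'))
    filter_upwards [hform, hsph] with x h1 h2
    rw [mem_sphere_zero_iff_norm] at h2
    rcases lt_or_gt_of_ne h2 with h3 | h3
    · simp [h1.1 h3, h3, h3.le, w, A]
    · simp [h1.2 h3, h3.le, w]
  have hdL (i : Fin 2) : MemLp (fun x ↦ lineDeriv ℝ w x (EuclideanSpace.single i 1)) 2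
      (volume.restrict Ω) := (hK.memLp_lineDeriv _).restrict _ |>.mono_exponent le_top
  have hd (i : Fin 2) (V : Set (RH 2)) := hK.isWeakPartial (Ω := V) i
  constructor
  · intro hW
    have hUΩ : ball (0 : RH 2) ((1 + ρ) / 2) ⊆ Ω := ball_subset_ball (by linarith)
    have hcl : closure (ball (0 : RH 2) ((1 + ρ) / 2)) ⊆ closedBall 0 ((1 + ρ) / 2) :=
      closure_ball_subset_closedBall
    obtain ⟨hu1, g', hg', h', hh', k', hk'⟩ := hW (ball 0 ((1 + ρ) / 2)) isOpen_ball
      ((isCompact_closedBall _ _).of_isClosed_subset isClosed_closure hcl)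
      (hcl.trans (closedBall_subset_ball (by linarith)))
    set U : Set (RH 2) := ball 0 ((1 + ρ) / 2)
    have hUfin : IsFiniteMeasure (volume.restrict U) := ⟨by simpa using measure_ball_lt_top⟩
    have hind : Integrable ((ball (0 : RH 2) ρ).indicator fun _ ↦ A) (volume.restrict U) :=
      (integrable_const A).indicator measurableSet_ball
    have hwi : Integrable w (volume.restrict U) :=
      (hK.continuous.continuousOn.integrableOn_compact
        (isCompact_closedBall (0 : RH 2) ((1 + ρ) / 2))).mono_set ball_subset_closedBall
    have hdi : Integrable (fun x ↦ lineDeriv ℝ w x (EuclideanSpace.single (0 : Fin 2) 1))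
        (volume.restrict U) :=
      ((hdL 0).mono_measure (Measure.restrict_mono hUΩ le_rfl)).integrable one_le_two
    have hki : Integrable (fun x ↦ ∑ i, k' i i 0 x) (volume.restrict U) :=
      integrable_finsetSum _ fun i _ ↦ memLp_one_iff_integrable.1 (hk' i i 0).2
    have hlap : IsWeakPartial U 0 (fun x ↦ w x - (ball (0 : RH 2) ρ).indicator (fun _ ↦ A) x)
        fun x ↦ ∑ i, k' i i 0 x := fun φ hφ ↦ by
      have hsum := IsWeakPartial.sum Finset.univ
        (fun i _ ↦ memLp_one_iff_integrable.1 (hh' i i).2)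
        (fun i _ ↦ memLp_one_iff_integrable.1 (hk' i i 0).2) (fun i _ ↦ (hk' i i 0).1) φ hφ
      have hφ' := hφ.cpderiv 0
      rw [← hsum, ← integral_mul_cLaplacian_cpderiv (memLp_one_iff_integrable.1 hu1)
        (fun i ↦ memLp_one_iff_integrable.1 (hh' i i).2) (fun i ↦ (hg' i).1)
        (fun i ↦ (hh' i i).1) hφ', ← hφ'.cLaplacian.setIntegral_mul_of_subset hUΩ,
        hlapu _ (hφ'.mono hUΩ), ← hφ'.setIntegral_mul_of_subset hUΩ]
      refine integral_congr_ae ?_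
      filter_upwards [hae] with x hx
      rw [hx]
    have hjump := IsWeakPartial.sub hwi (hwi.sub hind) hdi hki (hd 0 U) hlap
    simp only [Pi.sub_apply, sub_sub_cancel] at hjump
    exact eq_zero_of_isWeakPartial_indicator_ball hρ0 (by linarith) (hdi.sub hki) hjump
  · intro hA0 U hUo _ hUΩ'
    have hUΩ : U ⊆ Ω := subset_closure.trans hUΩ'
    obtain ⟨r, hr, hUr⟩ := exists_lt_subset_ball isClosed_closure hUΩ'
    let b : ContDiffBump (0 : RH 2) := ⟨max r (1 / 2), (1 + max r (1 / 2)) / 2,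
      by positivity, by linarith [max_lt hr one_half_lt_one]⟩
    have hb : IsTestFun Ω b := ⟨b.contDiff, b.hasCompactSupport, by
      rw [b.tsupport_eq]
      exact closedBall_subset_ball (by
        simp only [b]
        linarith [max_lt hr one_half_lt_one])⟩
    have hbU (x : RH 2) (hx : x ∈ U) : b x = 1 :=
      b.one_of_mem_closedBall ((ball_subset_ball (le_max_left _ _)).trans
        ball_subset_closedBall (hUr (subset_closure hx)))
    have hgF (i : Fin 2) : IsWeakLaplacian Ω (g i)
        fun x ↦ lineDeriv ℝ w x (EuclideanSpace.single i 1) := fun φ hφ ↦ by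
      have h1 := (hg i).1 _ hφ.cLaplacian
      rw [cpderiv_cLaplacian hφ.1, hlapu _ (hφ.cpderiv i)] at h1
      have h2 : ∫ x in Ω, lapu x * cpderiv i φ x = ∫ x in Ω, w x * cpderiv i φ x := by
        refine integral_congr_ae ?_
        filter_upwards [hae] with x hx
        simp [hx, hA0]
      rw [h2, hd i Ω φ hφ] at h1
      exact (neg_injective h1).symm
    choose k hk hkφ using fun i j l ↦ exists_memLp_cpderiv_cpderiv measurableSet_ball hUΩ hb hbU
      (hg i).2 (hdL i) (fun j ↦ (hh i j).2) (fun j ↦ (hh i j).1) (hgF i) j l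
    have hUfin : IsFiniteMeasure (volume.restrict U) :=
      ⟨by simpa using (measure_mono hUΩ).trans_lt measure_ball_lt_top⟩
    have hres {f : RH 2 → ℝ} (hf : MemLp f 2 (volume.restrict Ω)) :
        MemLp f 1 (volume.restrict U) :=
      (hf.mono_measure (Measure.restrict_mono hUΩ le_rfl)).mono_exponent one_le_two
    refine ⟨hres hu2, g, fun i ↦ ⟨(hg i).1.mono hUΩ, hres (hg i).2⟩, h,
      fun i j ↦ ⟨(hh i j).1.mono hUΩ, hres (hh i j).2⟩, k, fun i j l ↦ ⟨fun φ hφ ↦ ?_,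
        ((hk i j l).restrict U).mono_exponent one_le_two⟩⟩
    rw [← hkφ i j l φ hφ, (hh i j).1.mono hUΩ _ (hφ.cpderiv l), neg_neg]

end
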